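/- Let 0 < ε ≤ d/200 and 0 < d ≤ 1/100. Let G* be an oriented graph whose vertex set A is partitioned into sets A₁, …, A_k, each of size m, and put n = km. Let R be an oriented graph on [k] with δ⁰(R) ≥ (3/8 − 2d)k. Suppose every edge of G* goes from some A_i to some A_j with ij ∈ E(R), and for every edge ij ∈ E(R) the bipartite graph (A_i,A_j)_{G*} of all A_i–A_j edges is ε²-regular with density at least 3d/4. Then each A_i contains a set U_i of size 2εm such that, with U = ∪ᵢ U_i, the oriented graph G*[A∖U] has minimum semi-degree δ⁰(G*[A∖U]) ≥ dn/8. -/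

import Mathlib

open Set

namespace ArxivOG

variable {V : Type*}

/-- An oriented graph: at most one directed edge between any two vertices (and no loops). -/
def IsOriented (G : V → V → Prop) : Prop := ∀ x y : V, G x y → ¬ G y x

/-- Out-neighbourhood of a vertex. -/
def outN (G : V → V → Prop) (x : V) : Set V := {y | G x y}

/-- In-neighbourhood of a vertex. -/
def inN (G : V → V → Prop) (x : V) : Set V := {y | G y x}

/-- Outdegree of a vertex. -/
noncomputable def outDeg (G : V → V → Prop) (x : V) : ℕ := (outN G x).ncard

/-- Indegree of a vertex. -/
noncomputable def inDeg (G : V → V → Prop) (x : V) : ℕ := (inN G x).ncard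

/-- The set of all outneighbours of vertices in `S`. -/
def outNSet (G : V → V → Prop) (S : Set V) : Set V := {y | ∃ x ∈ S, G x y}

/-- Minimum outdegree `δ⁺`. -/
noncomputable def minOutDeg (G : V → V → Prop) : ℕ := sInf (Set.range (outDeg G))

/-- Minimum indegree `δ⁻`. -/
noncomputable def minInDeg (G : V → V → Prop) : ℕ := sInf (Set.range (inDeg G))

/-- Minimum semi-degree `δ⁰ = min (δ⁺, δ⁻)`. -/
noncomputable def minSemiDeg (G : V → V → Prop) : ℕ := min (minOutDeg G) (minInDeg G)

/-- A Hamilton cycle of a digraph, encoded as a permutation `σ` of the vertex set all of whose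
vertices lie on a single cycle and such that every vertex sends an edge to its successor. -/
def IsHamCycle (G : V → V → Prop) (σ : Equiv.Perm V) : Prop :=
  (∀ v, G v (σ v)) ∧ ∀ v w : V, σ.SameCycle v w

/-- The number of edges directed from `A` to `B`. -/
noncomputable def eCnt (G : V → V → Prop) (A B : Set V) : ℕ :=
  {p : V × V | p.1 ∈ A ∧ p.2 ∈ B ∧ G p.1 p.2}.ncard

/-- The density of the bipartite graph of all `A`–`B` edges. -/
noncomputable def dens (G : V → V → Prop) (A B : Set V) : ℝ :=
  (eCnt G A B : ℝ) / ((A.ncard : ℝ) * (B.ncard : ℝ))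

/-- The pair `(A,B)` is `ε`-regular. -/
def EpsRegular (ε : ℝ) (G : V → V → Prop) (A B : Set V) : Prop :=
  ∀ X ⊆ A, ∀ Y ⊆ B, ε * A.ncard < (X.ncard : ℝ) → ε * B.ncard < (Y.ncard : ℝ) →
    |dens G X Y - dens G A B| < ε

/-- The pair `(A,B)` is `(ε,d)`-super-regular. -/
def SuperRegular (ε d : ℝ) (G : V → V → Prop) (A B : Set V) : Prop :=
  EpsRegular ε G A B ∧
  (∀ a ∈ A, (d - ε) * B.ncard ≤ ((outN G a ∩ B).ncard : ℝ)) ∧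
  (∀ b ∈ B, (d - ε) * A.ncard ≤ ((inN G b ∩ A).ncard : ℝ))

/-- The cluster `V_i` of a partition encoded by `P : V → Option (Fin k)`. -/
def cluster {k : ℕ} (P : V → Option (Fin k)) (i : Fin k) : Set V := {x | P x = some i}

/-- The exceptional set `V₀` of a partition encoded by `P : V → Option (Fin k)`. -/
def cluster0 {k : ℕ} (P : V → Option (Fin k)) : Set V := {x | P x = none}

theorem eCnt_le_of_outN_inter_le [Finite V] (G : V → V → Prop) (X Y : Set V) (t : ℝ)
    (h : ∀ x ∈ X, ((outN G x ∩ Y).ncard : ℝ) ≤ t) : (eCnt G X Y : ℝ) ≤ X.ncard * t := by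
  classical
  cases nonempty_fintype V
  have key : eCnt G X Y = ∑ x ∈ X.toFinset, (outN G x ∩ Y).ncard := by
    unfold eCnt
    rw [Set.ncard_eq_toFinset_card', Finset.card_eq_sum_card_fiberwise (f := Prod.fst)
      (t := X.toFinset) (by intro p hp; simp at hp; simp [hp.1])]
    refine Finset.sum_congr rfl fun x hx => ?_
    rw [← Set.ncard_coe_finset, ← Set.ncard_image_of_injective (outN G x ∩ Y)
      (Prod.mk_right_injective x)]
    congr 1
    ext ⟨a, b⟩
    simp only [Set.mem_toFinset] at hx
    simp only [Finset.coe_filter, Set.mem_toFinset, Set.mem_ofPred_eq, Set.mem_image,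
      Set.mem_inter_iff, outN, Prod.mk.injEq]
    constructor
    · rintro ⟨⟨_, hb, hG⟩, rfl⟩
      exact ⟨b, ⟨hG, hb⟩, rfl, rfl⟩
    · rintro ⟨c, ⟨hG, hb⟩, rfl, rfl⟩
      exact ⟨⟨hx, hb, hG⟩, rfl⟩
  rw [key, Nat.cast_sum, Set.ncard_eq_toFinset_card', ← nsmul_eq_mul]
  exact Finset.sum_le_card_nsmul _ _ _ fun x hx => h x (by simpa using hx)

theorem eCnt_flip (G : V → V → Prop) (X Y : Set V) :
    eCnt (fun x y => G y x) X Y = eCnt G Y X := by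
  unfold eCnt
  rw [← Set.ncard_image_of_injective _ Prod.swap_injective]
  congr 1
  ext ⟨a, b⟩
  simp only [Set.image_swap_eq_preimage_swap, Set.mem_preimage, Set.mem_ofPred_eq, Prod.fst_swap,
    Prod.snd_swap]
  tauto

theorem dens_flip (G : V → V → Prop) (X Y : Set V) :
    dens (fun x y => G y x) X Y = dens G Y X := by
  unfold dens
  rw [eCnt_flip, mul_comm]

theorem EpsRegular.flip {ε : ℝ} {G : V → V → Prop} {A B : Set V} (h : EpsRegular ε G A B) :
    EpsRegular ε (fun x y => G y x) B A := by
  intro X hX Y hY hX' hY'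
  rw [dens_flip G, dens_flip G]
  exact h Y hY X hX hY' hX'

theorem EpsRegular.ncard_outN_inter_lt_le [Finite V] {ε δ : ℝ} {G : V → V → Prop} {A B : Set V}
    (h : EpsRegular ε G A B) (hε : 0 ≤ ε) (hε1 : ε < 1) (hδ : δ ≤ dens G A B) :
    ({x ∈ A | ((outN G x ∩ B).ncard : ℝ) < (δ - ε) * B.ncard}.ncard : ℝ) ≤ ε * A.ncard := by
  set X := {x ∈ A | ((outN G x ∩ B).ncard : ℝ) < (δ - ε) * B.ncard} with hX
  by_contra! hlt
  have hXpos : (0 : ℝ) < X.ncard := lt_of_le_of_lt (by positivity) hlt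
  have hBpos : (0 : ℝ) < B.ncard := by
    obtain ⟨x, hx⟩ := Set.nonempty_of_ncard_ne_zero (by exact_mod_cast hXpos.ne' : X.ncard ≠ 0)
    rcases (Nat.cast_nonneg B.ncard : (0 : ℝ) ≤ _).lt_or_eq with hB | hB
    · exact hB
    · have := hx.2
      rw [← hB, mul_zero] at this
      exact absurd this (not_lt.mpr (Nat.cast_nonneg _))
  have hreg := h X (fun x hx => hx.1) B le_rfl hlt (by nlinarith)
  have hle : dens G X B ≤ δ - ε := by
    unfold dens
    rw [div_le_iff₀ (by positivity)]
    have := eCnt_le_of_outN_inter_le G X B _ fun x hx => (hx.2).le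
    linarith
  have := (abs_lt.mp hreg).1
  linarith

theorem EpsRegular.adj_of_mul_ncard_lt_one {ε : ℝ} {G : V → V → Prop} {A B : Set V}
    (h : EpsRegular ε G A B) (hA : ε * A.ncard < 1) (hB : ε * B.ncard < 1)
    (hδ : ε ≤ dens G A B) {a b : V} (ha : a ∈ A) (hb : b ∈ B) : G a b := by
  by_contra hab
  have h1 := h {a} (by simpa using ha) {b} (by simpa using hb) (by simpa using hA)
    (by simpa using hB)
  have h0 : eCnt G {a} {b} = 0 := by
    unfold eCnt
    convert Set.ncard_empty (V × V)
    ext ⟨x, y⟩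
    simp only [Set.mem_singleton_iff, Set.mem_ofPred_eq, Set.mem_empty_iff_false, iff_false]
    rintro ⟨rfl, rfl, hG⟩
    exact hab hG
  have h2 : dens G {a} {b} = 0 := by simp [dens, h0]
  rw [h2] at h1
  have := (abs_lt.mp h1).1
  linarith

open Classical in
theorem card_filter_mul_card_lt_le {α ι : Type*} (A : Finset α) (N : Finset ι)
    (bad : α → ι → Prop) {ε m : ℝ} (hε : 0 < ε) (hm : 0 ≤ m)
    (h : ∀ j ∈ N, ((A.filter fun v => bad v j).card : ℝ) ≤ ε ^ 2 * m) :
    ((A.filter fun v => ε * N.card < ((N.filter fun j => bad v j).card : ℝ)).card : ℝ)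
      ≤ ε * m := by
  set B := A.filter fun v => ε * N.card < ((N.filter fun j => bad v j).card : ℝ) with hB
  rcases N.eq_empty_or_nonempty with rfl | hN
  · have : B = ∅ := by simp [hB]
    rw [this]
    simp only [Finset.card_empty, Nat.cast_zero]
    positivity
  have hNpos : (0 : ℝ) < N.card := by exact_mod_cast hN.card_pos
  have hcount : ∑ v ∈ A, (N.filter fun j => bad v j).card =
      ∑ j ∈ N, (A.filter fun v => bad v j).card :=
    Finset.sum_card_bipartiteAbove_eq_sum_card_bipartiteBelow bad
  have hlow : B.card * (ε * N.card) ≤ (∑ v ∈ A, (N.filter fun j => bad v j).card : ℝ) := by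
    rw [← nsmul_eq_mul]
    refine (Finset.card_nsmul_le_sum B _ _ fun v hv => (Finset.mem_filter.mp hv).2.le).trans ?_
    exact Finset.sum_le_sum_of_subset_of_nonneg (Finset.filter_subset _ _)
      fun _ _ _ => Nat.cast_nonneg _
  have hupp : (∑ j ∈ N, (A.filter fun v => bad v j).card : ℝ) ≤ N.card * (ε ^ 2 * m) := by
    rw [← nsmul_eq_mul]
    exact Finset.sum_le_card_nsmul _ _ _ h
  have hcount' : (∑ v ∈ A, (N.filter fun j => bad v j).card : ℝ) =
      (∑ j ∈ N, (A.filter fun v => bad v j).card : ℝ) := by exact_mod_cast hcount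
  have : (B.card : ℝ) * (ε * N.card) ≤ (ε * m) * (ε * N.card) := by linarith
  exact le_of_mul_le_mul_right this (by positivity)

theorem card_mul_le_ncard_diff_iUnion {k m : ℕ} (S : Set (Fin k × Fin m))
    (U : Fin k → Set (Fin k × Fin m)) (u : ℕ) (t : ℝ)
    (hU : ∀ i, U i ⊆ {v | v.1 = i} ∧ (U i).ncard = u) (N : Finset (Fin k))
    (hN : ∀ j ∈ N, t ≤ ((S ∩ {v | v.1 = j}).ncard : ℝ)) :
    (N.card : ℝ) * (t - u) ≤ ((S \ ⋃ i, U i).ncard : ℝ) := by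
  classical
  have hle : ∑ j ∈ N, ((S ∩ {v | v.1 = j}) \ U j).ncard ≤ (S \ ⋃ i, U i).ncard := by
    rw [Set.ncard_eq_toFinset_card' (S \ ⋃ i, U i)]
    refine le_trans (le_of_eq ?_) ((Finset.sum_card_fiberwise_eq_card_filter
      (S \ ⋃ i, U i).toFinset N Prod.fst).trans_le (Finset.card_filter_le _ _))
    refine Finset.sum_congr rfl fun j _ => ?_
    rw [← Set.ncard_coe_finset]
    congr 1
    ext v
    simp only [Set.mem_sdiff, Set.mem_inter_iff, Set.mem_ofPred_eq, Finset.coe_filter,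
      Set.mem_toFinset, Set.mem_iUnion, not_exists]
    constructor
    · rintro ⟨⟨hS, rfl⟩, hv⟩
      refine ⟨⟨hS, fun i hi => ?_⟩, rfl⟩
      obtain rfl : v.1 = i := (hU i).1 hi
      exact hv hi
    · rintro ⟨⟨hS, hv⟩, rfl⟩
      exact ⟨⟨hS, rfl⟩, hv _⟩
  have hterm : ∀ j ∈ N, t - u ≤ (((S ∩ {v | v.1 = j}) \ U j).ncard : ℝ) := by
    intro j hj
    have h1 := Set.le_ncard_sdiff (U j) (S ∩ {v | v.1 = j})
    rw [(hU j).2, Nat.sub_le_iff_le_add] at h1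
    have h2 : ((S ∩ {v | v.1 = j}).ncard : ℝ) ≤ ((S ∩ {v | v.1 = j}) \ U j).ncard + u := by
      exact_mod_cast h1
    linarith [hN j hj]
  rw [← nsmul_eq_mul]
  refine (Finset.card_nsmul_le_sum N _ _ hterm).trans ?_
  exact_mod_cast hle

theorem ncard_fiber_fst {k m : ℕ} (i : Fin k) : {v : Fin k × Fin m | v.1 = i}.ncard = m := by
  have : {v : Fin k × Fin m | v.1 = i} = Prod.mk i '' Set.univ := by
    ext ⟨a, b⟩
    simp [eq_comm]
  rw [this, Set.ncard_image_of_injective _ (Prod.mk_right_injective i), Set.ncard_univ]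
  simp

/-- If every pair of clusters along an edge of `R` is regular and dense, then up to a few
exceptional vertices each vertex has large outdegree into almost all the relevant clusters. When
`ε ^ 2 * m < 1` the pairs are complete, so that "large" means everything. -/
theorem exists_exceptional_set {d ε : ℝ} (hd : 0 < d) (hd1 : d ≤ 1 / 100) (hε : 0 < ε)
    (hεd : ε ≤ d / 200) {k m : ℕ} (G : Fin k × Fin m → Fin k × Fin m → Prop)
    (R : Fin k → Fin k → Prop)
    (hreg : ∀ i j : Fin k, R i j → EpsRegular (ε ^ 2) G {v | v.1 = i} {v | v.1 = j} ∧
      3 * d / 4 ≤ dens G {v | v.1 = i} {v | v.1 = j}) (i : Fin k) :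
    ∃ B : Set (Fin k × Fin m), B ⊆ {v | v.1 = i} ∧ (B.ncard : ℝ) ≤ ε * m ∧
      ∀ v : Fin k × Fin m, v.1 = i → v ∉ B → ∃ N : Finset (Fin k),
        (1 - ε) * outDeg R i ≤ N.card ∧ ∀ j ∈ N,
          (if ε ^ 2 * m < 1 then (m : ℝ) else (3 * d / 4 - ε ^ 2) * m) ≤
            ((outN G v ∩ {w | w.1 = j}).ncard : ℝ) := by
  classical
  set t : ℝ := if ε ^ 2 * m < 1 then (m : ℝ) else (3 * d / 4 - ε ^ 2) * m with ht
  have hε2 : ε ^ 2 ≤ 3 * d / 4 := by nlinarith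
  have hbad : ∀ j, R i j → ({v ∈ {v : Fin k × Fin m | v.1 = i} |
      ((outN G v ∩ {w | w.1 = j}).ncard : ℝ) < t}.ncard : ℝ) ≤ ε ^ 2 * m := by
    intro j hj
    obtain ⟨hr, hdens⟩ := hreg i j hj
    by_cases hm : ε ^ 2 * m < 1
    · have hempty : {v ∈ {v : Fin k × Fin m | v.1 = i} |
          ((outN G v ∩ {w | w.1 = j}).ncard : ℝ) < t} = ∅ := by
        refine Set.eq_empty_of_forall_notMem fun v hv => ?_
        have hfull : outN G v ∩ {w | w.1 = j} = {w | w.1 = j} :=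
          Set.inter_eq_right.mpr fun w hw =>
            hr.adj_of_mul_ncard_lt_one (by rwa [ncard_fiber_fst]) (by rwa [ncard_fiber_fst])
              (hε2.trans hdens) hv.1 hw
        have := hv.2
        rw [hfull, ncard_fiber_fst, ht, if_pos hm] at this
        exact lt_irrefl _ this
      rw [hempty, Set.ncard_empty, Nat.cast_zero]
      positivity
    · have := hr.ncard_outN_inter_lt_le (by positivity) (by nlinarith) hdens
      simp only [ncard_fiber_fst] at this
      rwa [ht, if_neg hm]
  set A : Finset (Fin k × Fin m) := Finset.univ.filter fun v => v.1 = i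
  set N : Finset (Fin k) := Finset.univ.filter fun j => R i j with hN
  have hNcard : outDeg R i = N.card := by
    rw [outDeg, ← Set.ncard_coe_finset]
    congr 1
    ext j
    simp [hN, outN]
  set bad : Fin k × Fin m → Fin k → Prop :=
    fun v j => ((outN G v ∩ {w | w.1 = j}).ncard : ℝ) < t with hbaddef
  have hcount := card_filter_mul_card_lt_le A N bad hε (Nat.cast_nonneg m) (by
    intro j hj
    have := hbad j (by simpa [hN] using hj)
    rw [← Set.ncard_coe_finset]
    convert this using 3
    ext v
    simp [A, bad])
  refine ⟨_, ?_, (Set.ncard_coe_finset _).symm ▸ hcount, ?_⟩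
  · intro v hv
    simp only [Finset.coe_filter, Set.mem_ofPred_eq] at hv
    simpa [A] using hv.1
  · intro v hvi hv
    refine ⟨N.filter fun j => ¬ bad v j, ?_, fun j hj => not_lt.mp (Finset.mem_filter.mp hj).2⟩
    have h1 : ((N.filter fun j => bad v j).card : ℝ) ≤ ε * N.card := by
      by_contra! hlt
      exact hv (by simpa [A, hvi] using hlt)
    have h2 : ((N.filter fun j => bad v j).card : ℝ) + (N.filter fun j => ¬ bad v j).card
        = N.card := by
      exact_mod_cast Finset.card_filter_add_card_filter_not (s := N) (fun j => bad v j)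
    rw [hNcard]
    linarith

theorem degree_threshold_sub_ceil {d ε : ℝ} (hd : 0 < d) (hd1 : d ≤ 1 / 100) (hε : 0 < ε)
    (hεd : ε ≤ d / 200) {m : ℕ} (hm : 2 ≤ m) :
    2 / 5 * d * m ≤ (if ε ^ 2 * m < 1 then (m : ℝ) else (3 * d / 4 - ε ^ 2) * m) -
      (⌈2 * ε * (m : ℝ)⌉₊ : ℝ) := by
  have hm2 : (2 : ℝ) ≤ m := by exact_mod_cast hm
  have hceil : (⌈2 * ε * (m : ℝ)⌉₊ : ℝ) < 2 * ε * m + 1 := Nat.ceil_lt_add_one (by positivity)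
  have h1 : ε * m ≤ d / 200 * m := by gcongr
  have h2 : d * m ≤ 1 / 100 * m := by gcongr
  split_ifs with h
  · linarith
  · have h3 : ε ^ 2 * m ≤ d / 200 * m := by
      have : ε ^ 2 ≤ d / 200 := by nlinarith
      gcongr
    linarith

theorem le_ncard_of_degree_bounds {d ε r : ℝ} (hd : 0 < d) (hd1 : d ≤ 1 / 100)
    (hεd : ε ≤ d / 200) {k m : ℕ} {N t c : ℝ} (hr : (3 / 8 - 2 * d) * k ≤ r)
    (hN : (1 - ε) * r ≤ N) (ht : 2 / 5 * d * m ≤ t) (hc : N * t ≤ c) :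
    d * ((k : ℝ) * m) / 8 ≤ c := by
  have hk : (0 : ℝ) ≤ k := Nat.cast_nonneg k
  have hm : (0 : ℝ) ≤ m := Nat.cast_nonneg m
  have h1 : 71 / 200 * (k : ℝ) ≤ r := le_trans (by gcongr; linarith) hr
  have h2 : 99 / 100 * (71 / 200 * (k : ℝ)) ≤ N :=
    le_trans (mul_le_mul (by linarith) h1 (by positivity) (by linarith)) hN
  have h3 : 99 / 100 * (71 / 200 * (k : ℝ)) * (2 / 5 * d * m) ≤ N * t :=
    mul_le_mul h2 ht (by positivity) (le_trans (by positivity) h2)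
  have h4 : 0 ≤ d * ((k : ℝ) * m) := by positivity
  linarith

/-- **Claim 1.2 (removing useless vertices).**
Let `0 < ε ≤ d/200` and `0 < d ≤ 1/100`. Let `G*` be an oriented graph whose vertex set is
partitioned into clusters `A₁, …, A_k` of size `m` (realised as `Fin k × Fin m`, with
`A_i = {v | v.1 = i}`, so `n = km`), and let `R` be an oriented graph on `[k]` with
`δ⁰(R) ≥ (3/8 - 2d)k` such that every edge of `G*` goes along an edge of `R` and every edge
`ij` of `R` corresponds to an `ε²`-regular pair of density at least `3d/4`. Then each `A_i`
contains a set `U_i` of size `2εm` such that `δ⁰(G*[A ∖ U]) ≥ dn/8` where `U = ⋃ U_i`. -/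
theorem min_semidegree_after_removing_useless_vertices :
    ∀ d ε : ℝ, 0 < d → d ≤ 1 / 100 → 0 < ε → ε ≤ d / 200 →
    ∀ k m : ℕ,
    ∀ Gstar : Fin k × Fin m → Fin k × Fin m → Prop, IsOriented Gstar →
    ∀ R : Fin k → Fin k → Prop, IsOriented R →
    (∀ i : Fin k, (3 / 8 - 2 * d) * k ≤ (min (outDeg R i) (inDeg R i) : ℝ)) →
    (∀ x y : Fin k × Fin m, Gstar x y → R x.1 y.1) →
    (∀ i j : Fin k, R i j →
      EpsRegular (ε ^ 2) Gstar {v : Fin k × Fin m | v.1 = i} {v : Fin k × Fin m | v.1 = j} ∧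
      3 * d / 4 ≤ dens Gstar {v : Fin k × Fin m | v.1 = i} {v : Fin k × Fin m | v.1 = j}) →
    ∃ U : Fin k → Set (Fin k × Fin m),
      (∀ i : Fin k, U i ⊆ {v : Fin k × Fin m | v.1 = i} ∧
        (U i).ncard = ⌈2 * ε * (m : ℝ)⌉₊) ∧
      ∀ v : Fin k × Fin m, v ∉ (⋃ i, U i) →
        d * ((k : ℝ) * m) / 8 ≤ ((outN Gstar v \ ⋃ i, U i).ncard : ℝ) ∧
        d * ((k : ℝ) * m) / 8 ≤ ((inN Gstar v \ ⋃ i, U i).ncard : ℝ) := by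
  intro d ε hd hd1 hε hεd k m G _ R _ hR _ hreg
  choose B hBsub hBcard hB using exists_exceptional_set hd hd1 hε hεd G R hreg
  choose C hCsub hCcard hC using exists_exceptional_set hd hd1 hε hεd (fun x y => G y x)
    (fun i j => R j i) (fun i j hij => ⟨(hreg j i hij).1.flip, by
      rw [dens_flip]; exact (hreg j i hij).2⟩)
  have hUex : ∀ i, ∃ U, B i ∪ C i ⊆ U ∧ U ⊆ {v : Fin k × Fin m | v.1 = i} ∧
      U.ncard = ⌈2 * ε * (m : ℝ)⌉₊ := by
    intro i
    refine Set.exists_subsuperset_card_eq (Set.union_subset (hBsub i) (hCsub i)) ?_ ?_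
    · have h1 : ((B i ∪ C i).ncard : ℝ) ≤ (B i).ncard + (C i).ncard := by
        exact_mod_cast Set.ncard_union_le _ _
      have h2 : ((B i ∪ C i).ncard : ℝ) ≤ ⌈2 * ε * (m : ℝ)⌉₊ :=
        le_trans (by linarith [hBcard i, hCcard i]) (Nat.le_ceil _)
      exact_mod_cast h2
    · rw [ncard_fiber_fst, Nat.ceil_le]
      have : (0 : ℝ) ≤ m := Nat.cast_nonneg m
      nlinarith
  choose U hBCU hUsub hUcard using hUex
  have hU : ∀ i, U i ⊆ {v : Fin k × Fin m | v.1 = i} ∧ (U i).ncard = ⌈2 * ε * (m : ℝ)⌉₊ :=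
    fun i => ⟨hUsub i, hUcard i⟩
  refine ⟨U, hU, fun v hv => ?_⟩
  have hvU : v ∉ U v.1 := fun h => hv (Set.mem_iUnion.mpr ⟨v.1, h⟩)
  have hmpos : 0 < m := v.2.pos
  have hm : 2 ≤ m := by
    by_contra! hlt
    have hlt' : (U v.1).ncard < m := by
      conv_rhs => rw [← ncard_fiber_fst (m := m) v.1]
      exact Set.ncard_lt_ncard ((Set.ssubset_iff_of_subset (hUsub v.1)).mpr ⟨v, rfl, hvU⟩)
    have hpos : 0 < (U v.1).ncard := by
      rw [hUcard, Nat.ceil_pos]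
      positivity
    omega
  have ht := degree_threshold_sub_ceil hd hd1 hε hεd hm
  have hRv := le_min_iff.mp (by simpa using hR v.1 :
    (3 / 8 - 2 * d) * (k : ℝ) ≤ min (outDeg R v.1 : ℝ) (inDeg R v.1))
  obtain ⟨N, hN, hNt⟩ := hB v.1 v rfl fun h => hvU (hBCU _ (Or.inl h))
  obtain ⟨M, hM, hMt⟩ := hC v.1 v rfl fun h => hvU (hBCU _ (Or.inr h))
  exact ⟨le_ncard_of_degree_bounds hd hd1 hεd hRv.1 hN ht
      (card_mul_le_ncard_diff_iUnion _ U _ _ hU N hNt),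
    le_ncard_of_degree_bounds hd hd1 hεd hRv.2 hM ht
      (card_mul_le_ncard_diff_iUnion _ U _ _ hU M hMt)⟩

end ArxivOG
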